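/- Fix a positive integer k. With probability 1 - negl(n) over G ~ G(n,1/2), for every vertex set S of size k and every family 𝔅 of nonempty subsets of S, there exists a vertex v ∉ S such that for all nonempty B ⊆ S: B ∈ 𝔅 if and only if the number of vertices adjacent to every vertex of {v} ∪ B and non-adjacent to every vertex of S \ B is odd. -/

import Mathlib

open Classical

/-- Adjacency in the graph on `Fin n` encoded by `g`. -/
def GAdj {n : ℕ} (g : Fin n → Fin n → Bool) (a b : Fin n) : Prop :=
  (a < b ∧ g a b = true) ∨ (b < a ∧ g b a = true)

/-- The parity-pattern property: for every `k`-set `S` of vertices and every family `𝔅`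
of nonempty subsets of `S`, there is `v ∉ S` such that for all nonempty `B ⊆ S`:
`B ∈ 𝔅` iff the number of vertices adjacent to every vertex of `{v} ∪ B` and
non-adjacent to every vertex of `S \ B` is odd. -/
def ParityPatternProp (k : ℕ) {n : ℕ} (g : Fin n → Fin n → Bool) : Prop :=
  ∀ S : Finset (Fin n), S.card = k →
    ∀ F : Finset (Finset (Fin n)), (∀ B ∈ F, B ⊆ S ∧ B.Nonempty) →
      ∃ v, v ∉ S ∧ ∀ B ⊆ S, B.Nonempty →
        (B ∈ F ↔ Odd ((Finset.univ.filter (fun w : Fin n =>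
          (∀ u ∈ insert v B, GAdj g w u) ∧ (∀ u ∈ S \ B, ¬ GAdj g w u))).card))

/-- Abstract independence lemma: resampling maps. -/
lemma resample_bound {Ω ι α : Type*} [Fintype Ω] (E : Ω → Prop) (bad : ι → Ω → Prop)
    (H : Finset α) (hH : 0 < H.card) (σ : ι → α → Ω → Ω)
    (hinj : ∀ v h, Function.Injective (σ v h)) :
    ∀ T : Finset ι,
    (∀ v ∈ T, ∀ h ∈ H, ∀ ω, E ω → E (σ v h ω)) →
    (∀ v ∈ T, ∀ v' ∈ T, v' ≠ v → ∀ h ∈ H, ∀ ω, bad v' ω → bad v' (σ v h ω)) →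
    (∀ v ∈ T, ∀ ω, E ω → ∃ h ∈ H, ¬ bad v (σ v h ω)) →
    ((Finset.univ.filter (fun ω => E ω ∧ ∀ v ∈ T, bad v ω)).card : ℝ) ≤
      (1 - 1 / (H.card : ℝ)) ^ T.card * (Fintype.card Ω : ℝ) := by
  intro T
  induction T using Finset.induction_on with
  | empty =>
    intro _ _ _
    simp only [Finset.card_empty, pow_zero, one_mul]
    exact_mod_cast Finset.card_le_univ _
  | insert v T hv ih =>
    intro hE hb hg
    have ih' := ih (fun v hv => hE v (Finset.mem_insert_of_mem hv))
      (fun v hv v' hv' => hb v (Finset.mem_insert_of_mem hv) v' (Finset.mem_insert_of_mem hv'))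
      (fun v hv => hg v (Finset.mem_insert_of_mem hv))
    set A := Finset.univ.filter (fun ω => E ω ∧ ∀ v ∈ T, bad v ω) with hA
    have hvT := Finset.mem_insert_self v T
    have h1 : A.card ≤ H.card * (A.filter (fun ω => ¬ bad v ω)).card := by
      have hsub : A ⊆ H.biUnion (fun h => A.filter (fun ω => ¬ bad v (σ v h ω))) := by
        intro ω hω
        have hω' := hω
        rw [hA, Finset.mem_filter] at hω'
        obtain ⟨h, hh, hgood⟩ := hg v hvT ω hω'.2.1
        rw [Finset.mem_biUnion]
        exact ⟨h, hh, Finset.mem_filter.2 ⟨hω, hgood⟩⟩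
      refine (Finset.card_le_card hsub).trans (Finset.card_biUnion_le_card_mul _ _ _ ?_)
      intro h hh
      refine Finset.card_le_card_of_injOn (σ v h) ?_ ((hinj v h).injOn)
      intro ω hω
      simp only [hA, Finset.coe_filter, Finset.mem_filter, Finset.mem_univ, true_and,
        Set.mem_ofPred_eq] at hω ⊢
      refine ⟨⟨hE v hvT h hh ω hω.1.1, fun v' hv' => ?_⟩, hω.2⟩
      exact hb v hvT v' (Finset.mem_insert_of_mem hv') (fun e => hv (e ▸ hv')) h hh ω
        (hω.1.2 v' hv')
    have h2 : (A.filter (fun ω => bad v ω)).card + (A.filter (fun ω => ¬ bad v ω)).card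
        = A.card := Finset.card_filter_add_card_filter_not _
    have h3 : Finset.univ.filter (fun ω => E ω ∧ ∀ v' ∈ insert v T, bad v' ω)
        = A.filter (fun ω => bad v ω) := by
      ext ω
      simp only [hA, Finset.mem_filter, Finset.mem_univ, true_and, Finset.forall_mem_insert]
      tauto
    rw [h3, Finset.card_insert_of_notMem hv, pow_succ]
    have hM : (0 : ℝ) < H.card := by exact_mod_cast hH
    have hM1 : (1 : ℝ) ≤ H.card := by exact_mod_cast hH
    have h1' : (A.card : ℝ) ≤ H.card * ((A.filter (fun ω => ¬ bad v ω)).card : ℝ) := by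
      exact_mod_cast h1
    have h2' : ((A.filter (fun ω => bad v ω)).card : ℝ)
        + ((A.filter (fun ω => ¬ bad v ω)).card : ℝ) = A.card := by exact_mod_cast h2
    have h4 : (A.card : ℝ) / H.card ≤ ((A.filter (fun ω => ¬ bad v ω)).card : ℝ) := by
      rw [div_le_iff₀ hM]; linarith
    have h5 : ((A.filter (fun ω => bad v ω)).card : ℝ) ≤ (1 - 1 / (H.card : ℝ)) * A.card := by
      have : (1 - 1 / (H.card : ℝ)) * A.card = A.card - (A.card : ℝ) / H.card := by ring
      rw [this]; linarith
    have h6 : (0 : ℝ) ≤ 1 - 1 / (H.card : ℝ) := by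
      rw [sub_nonneg, div_le_one hM]; exact hM1
    calc _ ≤ _ := h5
      _ ≤ (1 - 1 / (H.card : ℝ)) * ((1 - 1 / (H.card : ℝ)) ^ T.card * (Fintype.card Ω : ℝ)) :=
        mul_le_mul_of_nonneg_left ih' h6
      _ = _ := by ring

/-- Toggle the edges from `v` to `X`. -/
def tog {n : ℕ} (v : Fin n) (X : Finset (Fin n)) (g : Fin n → Fin n → Bool) :
    Fin n → Fin n → Bool :=
  fun a b => xor (g a b) (decide ((a = v ∧ b ∈ X) ∨ (b = v ∧ a ∈ X)))

lemma tog_tog {n : ℕ} (v : Fin n) (X : Finset (Fin n)) (g : Fin n → Fin n → Bool) :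
    tog v X (tog v X g) = g := by
  funext a b
  simp [tog]

lemma gadj_symm {n : ℕ} (g : Fin n → Fin n → Bool) (a b : Fin n) :
    GAdj g a b ↔ GAdj g b a := by
  unfold GAdj; tauto

/-- toggling does not affect pairs which are not toggled -/
lemma gadj_tog_of_not {n : ℕ} (v : Fin n) (X : Finset (Fin n)) (g : Fin n → Fin n → Bool)
    (a b : Fin n) (h1 : ¬ (a = v ∧ b ∈ X)) (h2 : ¬ (b = v ∧ a ∈ X)) :
    GAdj (tog v X g) a b ↔ GAdj g a b := by
  have e1 : tog v X g a b = g a b := by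
    unfold tog
    rw [decide_eq_false (by tauto)]; simp
  have e2 : tog v X g b a = g b a := by
    unfold tog
    rw [decide_eq_false (by tauto)]; simp
  unfold GAdj
  rw [e1, e2]

lemma gadj_tog_mem {n : ℕ} (v : Fin n) (X : Finset (Fin n)) (g : Fin n → Fin n → Bool)
    (hv : v ∉ X) (a : Fin n) (ha : a ∈ X) :
    GAdj (tog v X g) a v ↔ ¬ GAdj g a v := by
  have hne : a ≠ v := fun e => hv (e ▸ ha)
  have e1 : tog v X g a v = !g a v := by
    unfold tog
    rw [decide_eq_true (by tauto)]; simp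
  have e2 : tog v X g v a = !g v a := by
    unfold tog
    rw [decide_eq_true (by tauto)]; simp
  unfold GAdj
  rw [e1, e2]
  rcases lt_or_gt_of_ne hne with h | h
  · simp [h, h.not_gt]
  · simp [h, h.not_gt]

/-- Pattern of `w` on `S`. -/
noncomputable def Pat {n : ℕ} (S : Finset (Fin n)) (g : Fin n → Fin n → Bool) (w : Fin n) : Finset (Fin n) :=
  S.filter (fun u => GAdj g w u)

lemma pat_tog {n : ℕ} (S : Finset (Fin n)) (g : Fin n → Fin n → Bool) (v : Fin n)
    (X : Finset (Fin n)) (w : Fin n) (h1 : v ∉ S) (h2 : w ≠ v ∨ Disjoint S X) :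
    Pat S (tog v X g) w = Pat S g w := by
  unfold Pat
  apply Finset.filter_congr
  intro u hu
  apply gadj_tog_of_not
  · rintro ⟨e, hX⟩
    rcases h2 with h2 | h2
    · exact h2 e
    · exact Finset.disjoint_left.1 h2 hu hX
  · rintro ⟨e, _⟩
    exact h1 (e ▸ hu)

/-- first event: no vertex in `W` has pattern `B` -/
lemma event1 {n : ℕ} (S W B : Finset (Fin n)) (hW : Disjoint S W) (hB : B ⊆ S) :
    ((Finset.univ.filter (fun g : Fin n → Fin n → Bool => ∀ w ∈ W, Pat S g w ≠ B)).card : ℝ) ≤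
      (1 - 1 / (2 : ℝ) ^ S.card) ^ W.card * (Fintype.card (Fin n → Fin n → Bool) : ℝ) := by
  have hWS : ∀ w ∈ W, w ∉ S := fun w hw hS => Finset.disjoint_left.1 hW hS hw
  have := resample_bound (Ω := Fin n → Fin n → Bool) (fun _ => True)
    (fun w g => Pat S g w ≠ B) S.powerset (by simp [Finset.card_powerset])
    (fun w h g => tog w h g)
    (fun w h => (Function.LeftInverse.injective (g := tog w h) (fun g => tog_tog w h g)))
    W (fun _ _ _ _ _ _ => trivial)
    (by
      intro w hw w' hw' hne h hh g hg
      show Pat S (tog w h g) w' ≠ B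
      rw [pat_tog S g w h w' (hWS w hw) (Or.inl hne)]
      exact hg)
    (by
      intro w hw g _
      refine ⟨S.filter (fun u => ¬ (GAdj g w u ↔ u ∈ B)), by simp, ?_⟩
      simp only [ne_eq, not_not]
      set h := S.filter (fun u => ¬ (GAdj g w u ↔ u ∈ B)) with hh
      have hwh : w ∉ h := fun hm => hWS w hw (Finset.mem_filter.1 hm).1
      ext u
      unfold Pat
      rw [Finset.mem_filter]
      constructor
      · rintro ⟨hu, had⟩
        by_cases huh : u ∈ h
        · rw [gadj_symm, gadj_tog_mem w h g hwh u huh, gadj_symm] at had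
          have := (Finset.mem_filter.1 huh).2
          tauto
        · rw [gadj_tog_of_not w h g w u (by tauto) (by tauto)] at had
          have : (GAdj g w u ↔ u ∈ B) := by
            by_contra hc
            exact huh (Finset.mem_filter.2 ⟨hu, hc⟩)
          tauto
      · intro huB
        refine ⟨hB huB, ?_⟩
        by_cases huh : u ∈ h
        · rw [gadj_symm, gadj_tog_mem w h g hwh u huh, gadj_symm]
          have := (Finset.mem_filter.1 huh).2
          tauto
        · rw [gadj_tog_of_not w h g w u (by tauto) (by tauto)]
          have : (GAdj g w u ↔ u ∈ B) := by
            by_contra hc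
            exact huh (Finset.mem_filter.2 ⟨hB huB, hc⟩)
          exact this.2 huB)
  simpa [Finset.card_powerset] using this

/-- common neighbours of `v` with pattern `B` -/
noncomputable def Cn {n : ℕ} (S : Finset (Fin n)) (g : Fin n → Fin n → Bool) (v : Fin n) (B : Finset (Fin n)) :
    Finset (Fin n) :=
  Finset.univ.filter (fun w => GAdj g w v ∧ Pat S g w = B)

/-- the minimal representatives in `W` of the patterns in `h` -/
noncomputable def MinRep {n : ℕ} (W : Finset (Fin n)) (p : Fin n → Finset (Fin n)) (h : Finset (Finset (Fin n))) :
    Finset (Fin n) :=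
  W.filter (fun w => p w ∈ h ∧ ∀ w' ∈ W, p w' = p w → w ≤ w')

lemma rep_sub {n : ℕ} (W : Finset (Fin n)) (p : Fin n → Finset (Fin n))
    (h : Finset (Finset (Fin n))) : MinRep W p h ⊆ W := Finset.filter_subset _ _

lemma odd_flip {α : Type*} [Fintype α] (P Q : α → Prop) [DecidablePred P] [DecidablePred Q] (w : α)
    (h1 : ∀ x, x ≠ w → (P x ↔ Q x)) (h2 : P w ↔ ¬ Q w) :
    Odd (Finset.univ.filter P).card ↔ ¬ Odd (Finset.univ.filter Q).card := by
  by_cases hQ : Q w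
  · have hP : ¬ P w := by tauto
    have e : Finset.univ.filter Q = insert w (Finset.univ.filter P) := by
      ext x
      by_cases hx : x = w
      · subst hx; simp [hQ]
      · simp [hx, h1 x hx]
    rw [e, Finset.card_insert_of_notMem (by simp [hP]), Nat.odd_add_one, not_not]
  · have hP : P w := by tauto
    have e : Finset.univ.filter P = insert w (Finset.univ.filter Q) := by
      ext x
      by_cases hx : x = w
      · subst hx; simp [hP]
      · simp [hx, h1 x hx]
    rw [e, Finset.card_insert_of_notMem (by simp [hQ]), Nat.odd_add_one]

lemma event2 {n : ℕ} (S T W : Finset (Fin n)) (F : Finset (Finset (Fin n)))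
    (hW : Disjoint S W) (hT : Disjoint S T) (hTW : Disjoint T W) :
    ((Finset.univ.filter (fun g : Fin n → Fin n → Bool =>
      (∀ B ∈ S.powerset, ∃ w ∈ W, Pat S g w = B) ∧
      ∀ v ∈ T, ¬ ∀ B ∈ S.powerset, (B ∈ F ↔ Odd (Cn S g v B).card))).card : ℝ) ≤
      (1 - 1 / (2 : ℝ) ^ (2 ^ S.card)) ^ T.card *
        (Fintype.card (Fin n → Fin n → Bool) : ℝ) := by
  -- outside the relevant sets we use the identity
  let σ : Fin n → Finset (Finset (Fin n)) → (Fin n → Fin n → Bool) → (Fin n → Fin n → Bool) :=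
    fun v h g => if v ∈ T then tog v (MinRep W (Pat S g) h) g else g
  have hTS : ∀ v ∈ T, v ∉ S := fun w hw hS => Finset.disjoint_left.1 hT hS hw
  have hTW' : ∀ v ∈ T, v ∉ W := fun w hw hS => Finset.disjoint_left.1 hTW hw hS
  have hσ : ∀ v ∈ T, ∀ h g, σ v h g = tog v (MinRep W (Pat S g) h) g := by
    intro v hv h g
    simp only [σ, if_pos hv]
  have hdis : ∀ p h, Disjoint S (MinRep W p h) := fun p h => hW.mono_right (rep_sub W p h)
  have hpat : ∀ v ∈ T, ∀ h g, Pat S (σ v h g) = Pat S g := by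
    intro v hv h g
    funext w
    rw [hσ v hv]
    exact pat_tog S g v _ w (hTS v hv) (Or.inr (hdis _ _))
  have := resample_bound (Ω := Fin n → Fin n → Bool)
    (fun g => ∀ B ∈ S.powerset, ∃ w ∈ W, Pat S g w = B)
    (fun v g => ¬ ∀ B ∈ S.powerset, (B ∈ F ↔ Odd (Cn S g v B).card))
    S.powerset.powerset (by simp [Finset.card_powerset])
    σ
    (by
      intro v h
      by_cases hv : v ∈ T
      · intro g g' e
        have e1 : Pat S g = Pat S g' := by rw [← hpat v hv h g, ← hpat v hv h g', e]
        rw [hσ v hv, hσ v hv, e1] at e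
        rw [← tog_tog v (MinRep W (Pat S g') h) g, e, tog_tog]
      · intro g g' e
        simpa only [σ, if_neg hv] using e)
    T
    (by
      intro v hv h _ g hg
      rw [hpat v hv]; exact hg)
    (by
      intro v hv v' hv' hne h _ g hg
      have : ∀ B, Cn S (σ v h g) v' B = Cn S g v' B := by
        intro B
        unfold Cn
        rw [hpat v hv]
        apply Finset.filter_congr
        intro w _
        rw [hσ v hv, gadj_tog_of_not]
        · rintro ⟨_, h2⟩
          exact hTW' v' hv' (rep_sub _ _ _ h2)
        · rintro ⟨h2, _⟩
          exact hne h2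
      simpa only [this] using hg)
    (by
      intro v hv g hg
      set h := S.powerset.filter (fun B => ¬ (B ∈ F ↔ Odd (Cn S g v B).card)) with hh
      refine ⟨h, by simp [hh], ?_⟩
      rw [not_not]
      intro B hB
      have hvX : v ∉ MinRep W (Pat S g) h := fun hm => hTW' v hv (rep_sub _ _ _ hm)
      by_cases hBh : B ∈ h
      · have hBF := (Finset.mem_filter.1 hBh).2
        obtain ⟨w0, hw0, hp0⟩ := hg B hB
        obtain ⟨w, hw, hwmin⟩ := Finset.exists_min_image (W.filter (fun w => Pat S g w = B)) id
          ⟨w0, Finset.mem_filter.2 ⟨hw0, hp0⟩⟩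
        rw [Finset.mem_filter] at hw
        have hwX : w ∈ MinRep W (Pat S g) h := by
          unfold MinRep
          rw [Finset.mem_filter]
          refine ⟨hw.1, by rw [hw.2]; exact hBh, fun w' hw' he => ?_⟩
          exact hwmin w' (Finset.mem_filter.2 ⟨hw', he.trans hw.2⟩)
        have key : Odd (Cn S (σ v h g) v B).card ↔ ¬ Odd (Cn S g v B).card := by
          unfold Cn
          rw [hpat v hv, hσ v hv]
          apply odd_flip _ _ w
          · intro x hx
            apply and_congr_left
            intro hxB
            by_cases hxX : x ∈ MinRep W (Pat S g) h
            · exfalso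
              have hx1 := Finset.mem_filter.1 hxX
              apply hx
              apply le_antisymm
              · exact hx1.2.2 w hw.1 (hw.2.trans hxB.symm)
              · exact hwmin x (Finset.mem_filter.2 ⟨hx1.1, hxB⟩)
            · exact gadj_tog_of_not _ _ _ _ _ (fun hc => hvX hc.2) (fun hc => hxX hc.2)
          · rw [gadj_tog_mem v _ g hvX w hwX]
            have := hw.2
            tauto
        rw [key]
        tauto
      · have hBF : B ∈ F ↔ Odd (Cn S g v B).card := by
          by_contra hc
          exact hBh (Finset.mem_filter.2 ⟨hB, hc⟩)
        have : Cn S (σ v h g) v B = Cn S g v B := by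
          unfold Cn
          rw [hpat v hv, hσ v hv]
          apply Finset.filter_congr
          intro x _
          apply and_congr_left
          intro hxB
          apply gadj_tog_of_not _ _ _ _ _ (fun hc => hvX hc.2)
          rintro ⟨_, hc⟩
          have := (Finset.mem_filter.1 hc).2.1
          rw [hxB] at this
          exact hBh this
        rw [this]; exact hBF)
  simpa [Finset.card_powerset] using this

lemma cn_eq {n : ℕ} (S : Finset (Fin n)) (g : Fin n → Fin n → Bool) (v : Fin n)
    (B : Finset (Fin n)) (hB : B ⊆ S) :
    (Finset.univ.filter (fun w : Fin n =>
          (∀ u ∈ insert v B, GAdj g w u) ∧ (∀ u ∈ S \ B, ¬ GAdj g w u))) = Cn S g v B := by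
  unfold Cn Pat
  apply Finset.filter_congr
  intro w _
  rw [Finset.forall_mem_insert, and_assoc]
  apply and_congr_right
  intro _
  constructor
  · rintro ⟨h1, h2⟩
    ext u
    rw [Finset.mem_filter]
    constructor
    · rintro ⟨hu, ha⟩
      by_contra hc
      exact h2 u (Finset.mem_sdiff.2 ⟨hu, hc⟩) ha
    · intro hu
      exact ⟨hB hu, h1 u hu⟩
  · intro e
    subst e
    refine ⟨fun u hu => (Finset.mem_filter.1 hu).2, fun u hu ha => ?_⟩
    rw [Finset.mem_sdiff] at hu
    exact hu.2 (Finset.mem_filter.2 ⟨hu.1, ha⟩)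

lemma count_bound (k n : ℕ) :
    ((Finset.univ.filter
          (fun g : Fin n → Fin n → Bool => ¬ ParityPatternProp k g)).card : ℝ) ≤
      (n : ℝ) ^ k * (2 * 2 ^ (2 ^ k) * (1 - 1 / (2 : ℝ) ^ (2 ^ k)) ^ ((n - k) / 2)
        * (Fintype.card (Fin n → Fin n → Bool) : ℝ)) := by
  set m := (n - k) / 2 with hm
  set r : ℝ := 1 - 1 / (2 : ℝ) ^ (2 ^ k) with hr
  set Om : ℝ := (Fintype.card (Fin n → Fin n → Bool) : ℝ) with hOm
  have hOm0 : 0 ≤ Om := by positivity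
  have h2k : k ≤ 2 ^ k := Nat.lt_two_pow_self.le
  have hr0 : 0 ≤ r := by
    rw [hr, sub_nonneg, div_le_one (by positivity)]
    exact one_le_pow₀ (by norm_num)
  have hr1 : r ≤ 1 := by
    rw [hr, sub_le_self_iff]; positivity
  have hq0 : (0 : ℝ) ≤ 1 - 1 / 2 ^ k := by
    rw [sub_nonneg, div_le_one (by positivity)]
    exact one_le_pow₀ (by norm_num)
  have hqr : (1 : ℝ) - 1 / 2 ^ k ≤ r := by
    rw [hr]
    apply sub_le_sub_left
    apply one_div_le_one_div_of_le (by positivity)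
    exact pow_le_pow_right₀ (by norm_num) h2k
  have hsplit : ∀ S : Finset (Fin n), S.card = k → ∃ T W : Finset (Fin n),
      Disjoint S W ∧ Disjoint S T ∧ Disjoint T W ∧ m ≤ T.card ∧ m ≤ W.card := by
    intro S hS
    have hc : Sᶜ.card = n - k := by rw [Finset.card_compl, hS, Fintype.card_fin]
    obtain ⟨T, hTs, hTc⟩ := Finset.exists_subset_card_eq (s := Sᶜ) (n := m) (by omega)
    refine ⟨T, Sᶜ \ T, ?_, ?_, Finset.disjoint_sdiff, hTc.ge, ?_⟩
    · exact disjoint_compl_right.mono_right Finset.sdiff_subset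
    · exact disjoint_compl_right.mono_right hTs
    · rw [Finset.card_sdiff_of_subset hTs]; omega
  choose! T W hSW hST hTW hTc hWc using hsplit
  let E1 : Finset (Fin n) → Finset (Fin n) → Finset (Fin n → Fin n → Bool) := fun S B =>
    Finset.univ.filter (fun g : Fin n → Fin n → Bool => ∀ w ∈ W S, Pat S g w ≠ B)
  let E2 : Finset (Fin n) → Finset (Finset (Fin n)) → Finset (Fin n → Fin n → Bool) := fun S F =>
    Finset.univ.filter (fun g : Fin n → Fin n → Bool =>
      (∀ B ∈ S.powerset, ∃ w ∈ W S, Pat S g w = B) ∧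
      ∀ v ∈ T S, ¬ ∀ B ∈ S.powerset, (B ∈ F ↔ Odd (Cn S g v B).card))
  let U : Finset (Fin n) → Finset (Fin n → Fin n → Bool) := fun S =>
    S.powerset.biUnion (E1 S) ∪ S.powerset.powerset.biUnion (E2 S)
  have hsub : Finset.univ.filter (fun g : Fin n → Fin n → Bool => ¬ ParityPatternProp k g) ⊆
      (Finset.powersetCard k Finset.univ).biUnion U := by
    intro g hg
    have hg := (Finset.mem_filter.1 hg).2
    unfold ParityPatternProp at hg
    push Not at hg
    obtain ⟨S, hS, F, hF, hv⟩ := hg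
    rw [Finset.mem_biUnion]
    refine ⟨S, Finset.mem_powersetCard.2 ⟨Finset.subset_univ _, hS⟩, ?_⟩
    rw [Finset.mem_union]
    by_cases hE : ∀ B ∈ S.powerset, ∃ w ∈ W S, Pat S g w = B
    · right
      rw [Finset.mem_biUnion]
      refine ⟨F, ?_, ?_⟩
      · rw [Finset.mem_powerset]
        intro B hB
        exact Finset.mem_powerset.2 (hF B hB).1
      · refine Finset.mem_filter.2 ⟨Finset.mem_univ _, hE, ?_⟩
        intro v hvT hall
        obtain ⟨B, hBS, _, hB⟩ := hv v (fun hS' => Finset.disjoint_left.1 (hST S hS) hS' hvT)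
        have := hall B (Finset.mem_powerset.2 hBS)
        rw [cn_eq S g v B hBS] at hB
        tauto
    · left
      push Not at hE
      obtain ⟨B, hB, hw⟩ := hE
      rw [Finset.mem_biUnion]
      exact ⟨B, hB, Finset.mem_filter.2 ⟨Finset.mem_univ _, hw⟩⟩
  have hU : ∀ S ∈ Finset.powersetCard k (Finset.univ : Finset (Fin n)),
      ((U S).card : ℝ) ≤ 2 * 2 ^ (2 ^ k) * r ^ m * Om := by
    intro S hS
    have hS := (Finset.mem_powersetCard.1 hS).2
    have b1 : ((S.powerset.biUnion (E1 S)).card : ℝ) ≤ 2 ^ k * (r ^ m * Om) := by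
      have h1 : ((S.powerset.biUnion (E1 S)).card : ℝ) ≤ ∑ B ∈ S.powerset, ((E1 S B).card : ℝ) := by
        exact_mod_cast Finset.card_biUnion_le
      refine h1.trans ((Finset.sum_le_card_nsmul _ _ (r ^ m * Om) ?_).trans_eq ?_)
      · intro B hB
        refine (event1 S (W S) B (hSW S hS) (Finset.mem_powerset.1 hB)).trans ?_
        rw [hS]
        apply mul_le_mul_of_nonneg_right _ hOm0
        exact (pow_le_pow_left₀ hq0 hqr _).trans (pow_le_pow_of_le_one hr0 hr1 (hWc S hS))
      · rw [Finset.card_powerset, hS]; simp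
    have b2 : ((S.powerset.powerset.biUnion (E2 S)).card : ℝ) ≤ 2 ^ (2 ^ k) * (r ^ m * Om) := by
      have h1 : ((S.powerset.powerset.biUnion (E2 S)).card : ℝ) ≤
          ∑ F ∈ S.powerset.powerset, ((E2 S F).card : ℝ) := by
        exact_mod_cast Finset.card_biUnion_le
      refine h1.trans ((Finset.sum_le_card_nsmul _ _ (r ^ m * Om) ?_).trans_eq ?_)
      · intro F _
        refine (event2 S (T S) (W S) F (hSW S hS) (hST S hS) (hTW S hS)).trans ?_
        rw [hS]
        apply mul_le_mul_of_nonneg_right _ hOm0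
        exact pow_le_pow_of_le_one hr0 hr1 (hTc S hS)
      · rw [Finset.card_powerset, Finset.card_powerset, hS]; simp
    have b3 : ((U S).card : ℝ) ≤ ((S.powerset.biUnion (E1 S)).card : ℝ) +
        ((S.powerset.powerset.biUnion (E2 S)).card : ℝ) := by
      exact_mod_cast Finset.card_union_le _ _
    have b4 : (2 : ℝ) ^ k * (r ^ m * Om) ≤ 2 ^ (2 ^ k) * (r ^ m * Om) := by
      apply mul_le_mul_of_nonneg_right _ (by positivity)
      exact pow_le_pow_right₀ (by norm_num) h2k
    linarith
  have h1 : ((Finset.univ.filter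
          (fun g : Fin n → Fin n → Bool => ¬ ParityPatternProp k g)).card : ℝ) ≤
      ∑ S ∈ Finset.powersetCard k (Finset.univ : Finset (Fin n)), ((U S).card : ℝ) := by
    exact_mod_cast (Finset.card_le_card hsub).trans Finset.card_biUnion_le
  refine h1.trans ((Finset.sum_le_card_nsmul _ _ _ hU).trans ?_)
  rw [Finset.card_powersetCard, nsmul_eq_mul]
  apply mul_le_mul_of_nonneg_right _ (by positivity)
  rw [Finset.card_univ, Fintype.card_fin]
  exact_mod_cast Nat.choose_le_pow n k

/-- For fixed `k ≥ 1`, with probability `1 - negl(n)` over `G ~ G(n,1/2)`, the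
parity-pattern property holds for all `S` of size `k` and all families `𝔅`. -/
theorem parity_pattern_whp (k : ℕ) (hk : 0 < k) :
    ∀ c : ℕ, ∃ N : ℕ, ∀ n ≥ N,
      ((Finset.univ.filter
          (fun g : Fin n → Fin n → Bool => ¬ ParityPatternProp k g)).card : ℝ) /
        (Fintype.card (Fin n → Fin n → Bool) : ℝ) ≤ 1 / (n : ℝ) ^ c := by
  intro c
  set r : ℝ := 1 - 1 / (2 : ℝ) ^ (2 ^ k) with hr
  have hr0 : 0 ≤ r := by
    rw [hr, sub_nonneg, div_le_one (by positivity)]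
    exact one_le_pow₀ (by norm_num)
  have hr1 : r < 1 := by
    rw [hr, sub_lt_self_iff]; positivity
  have ht := tendsto_pow_const_mul_const_pow_of_abs_lt_one (k + c) (r := r)
    (by rw [abs_of_nonneg hr0]; exact hr1)
  have ht2 := ht.const_mul ((2 * 2 ^ (2 ^ k) : ℝ) * ((k : ℝ) + 3) ^ (k + c))
  rw [mul_zero] at ht2
  have hev := ht2.eventually (gt_mem_nhds (zero_lt_one))
  obtain ⟨M, hM⟩ := Filter.eventually_atTop.1 hev
  refine ⟨2 * M + k + 2, fun n hn => ?_⟩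
  set m := (n - k) / 2 with hm
  have hmM : M ≤ m := by omega
  have hm1 : 1 ≤ m := by omega
  have hnm : n ≤ (k + 3) * m := by
    have h1 : n ≤ 2 * m + k + 1 := by omega
    have h2 : k * 1 ≤ k * m := Nat.mul_le_mul_left k hm1
    nlinarith
  have hnm' : (n : ℝ) ≤ ((k : ℝ) + 3) * m := by exact_mod_cast hnm
  have hn0 : (0 : ℝ) < n := by
    have : 0 < n := by omega
    exact_mod_cast this
  have hOm : (0 : ℝ) < (Fintype.card (Fin n → Fin n → Bool) : ℝ) := by
    exact_mod_cast Fintype.card_pos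
  have hfin := (hM m hmM).le
  have hpow : (n : ℝ) ^ (k + c) ≤ (((k : ℝ) + 3) * m) ^ (k + c) :=
    pow_le_pow_left₀ hn0.le hnm' _
  rw [div_le_div_iff₀ hOm (by positivity), one_mul]
  calc _ ≤ ((n : ℝ) ^ k * (2 * 2 ^ (2 ^ k) * r ^ m
        * (Fintype.card (Fin n → Fin n → Bool) : ℝ))) * (n : ℝ) ^ c :=
        mul_le_mul_of_nonneg_right (count_bound k n) (by positivity)
    _ = (2 * 2 ^ (2 ^ k) * r ^ m * (n : ℝ) ^ (k + c)) *
        (Fintype.card (Fin n → Fin n → Bool) : ℝ) := by rw [pow_add]; ring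
    _ ≤ 1 * (Fintype.card (Fin n → Fin n → Bool) : ℝ) := by
        apply mul_le_mul_of_nonneg_right _ hOm.le
        calc _ ≤ 2 * 2 ^ (2 ^ k) * r ^ m * (((k : ℝ) + 3) * m) ^ (k + c) :=
              mul_le_mul_of_nonneg_left hpow (by positivity)
          _ = _ := by rw [mul_pow]; ring
          _ ≤ 1 := hfin
    _ = _ := one_mul _
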